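/- Let e, e' ∈ ℝⁿ be orthonormal vectors and c₁, c₂ ∈ ℝ with (c₁,c₂) ≠ (0,0). Then the polynomial P(x) = c₁ (e'·x)(e·x) + c₂ (e·x) satisfies (1/2) · ( ∫_{B_{1/2}} |∇P|² dx ) / ( ∫_{∂B_{1/2}} P² dσ ) = ( c₁²/(2(n+2)) + c₂² ) / ( c₁²/(4(n+2)) + c₂² ), and in particular this quantity is at most 2. -/

import Mathlib

open MeasureTheory Metric
open scoped RealInnerProductSpace

/-- The surface measure on the sphere `∂B_ρ ⊆ ℝⁿ` of radius `ρ` centered at the origin: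
the pushforward of the surface measure `volume.toSphere` of the unit sphere under the
scaling `x ↦ ρ • x`, weighted by the Jacobian factor `ρ^(n-1)`. -/
noncomputable def sphereMeasure (n : ℕ) (ρ : ℝ) :
    Measure (EuclideanSpace ℝ (Fin n)) :=
  (ENNReal.ofReal (ρ ^ (n - 1))) •
    Measure.map
      (fun x : sphere (0 : EuclideanSpace ℝ (Fin n)) 1 =>
        ρ • (x : EuclideanSpace ℝ (Fin n)))
      ((volume : Measure (EuclideanSpace ℝ (Fin n))).toSphere)

section SphereMoments

variable {E : Type*} [NormedAddCommGroup E] [InnerProductSpace ℝ E] [FiniteDimensional ℝ E]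
  [MeasurableSpace E] [BorelSpace E]

/-- Polar coordinates for positively homogeneous functions on a ball. -/
lemma setIntegral_ball_of_homogeneous [Nontrivial E] {f : E → ℝ} {k : ℕ}
    (hf : ∀ r : ℝ, 0 < r → ∀ x, f (r • x) = r ^ k * f x) {ρ : ℝ} (hρ : 0 < ρ) :
    ∫ x in ball (0 : E) ρ, f x =
      ρ ^ (Module.finrank ℝ E + k) / (Module.finrank ℝ E + k) *
        ∫ y : sphere (0 : E) 1, f y ∂(volume : Measure E).toSphere := by
  have hdim : 0 < Module.finrank ℝ E := Module.finrank_pos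
  let g : ℝ → ℝ := (Set.Iio ρ).indicator (fun r => r ^ k)
  have hradial : ∫ r : Set.Ioi (0 : ℝ), g r ∂(Measure.volumeIoiPow (Module.finrank ℝ E - 1)) =
      ρ ^ (Module.finrank ℝ E + k) / (Module.finrank ℝ E + k) := by
    simp only [Measure.volumeIoiPow, ENNReal.ofReal]
    rw [integral_withDensity_eq_integral_smul
        (measurable_subtype_coe.pow_const _).real_toNNReal,
      integral_subtype_comap measurableSet_Ioi
        fun a ↦ Real.toNNReal (a ^ (Module.finrank ℝ E - 1)) • g a]
    calc ∫ a in Set.Ioi (0 : ℝ), Real.toNNReal (a ^ (Module.finrank ℝ E - 1)) • g a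
        = ∫ a in Set.Ioi (0 : ℝ),
            (Set.Iio ρ).indicator (fun r => r ^ (Module.finrank ℝ E - 1 + k)) a := by
          refine setIntegral_congr_fun measurableSet_Ioi fun x hx ↦ ?_
          simp only [NNReal.smul_def, Real.coe_toNNReal _ (pow_nonneg (Set.mem_Ioi.1 hx).le _),
            smul_eq_mul, g, Set.indicator_apply]
          split_ifs <;> ring
      _ = ∫ a in (0 : ℝ)..ρ, a ^ (Module.finrank ℝ E - 1 + k) := by
          rw [setIntegral_indicator measurableSet_Iio, Set.Ioi_inter_Iio,
            intervalIntegral.integral_of_le hρ.le, integral_Ioc_eq_integral_Ioo]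
      _ = _ := by
          rw [integral_pow]
          have : Module.finrank ℝ E - 1 + k + 1 = Module.finrank ℝ E + k := by omega
          rw [this, ← Nat.cast_add_one, this]
          rw [zero_pow (by omega), sub_zero, Nat.cast_add]
  calc ∫ x in ball (0 : E) ρ, f x
      = ∫ x : E, (ball (0 : E) ρ).indicator f x := (integral_indicator measurableSet_ball).symm
    _ = ∫ x : ({(0)}ᶜ : Set E), (ball (0 : E) ρ).indicator f x
          ∂((volume : Measure E).comap Subtype.val) := by
      rw [integral_subtype_comap (measurableSet_singleton _).compl,
        restrict_compl_singleton]
    _ = ∫ x : sphere (0 : E) 1 × Set.Ioi (0 : ℝ), f x.1 * g x.2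
          ∂(volume : Measure E).toSphere.prod (.volumeIoiPow (Module.finrank ℝ E - 1)) := by
      rw [← (volume : Measure E).measurePreserving_homeomorphUnitSphereProd.integral_comp
        (Homeomorph.measurableEmbedding _)]
      refine integral_congr_ae (.of_forall fun x => ?_)
      have hx : 0 < ‖(x : E)‖ := norm_pos_iff.2 x.2
      have hfx : f x = ‖(x : E)‖ ^ k * f (‖(x : E)‖⁻¹ • (x : E)) := by
        rw [← hf _ hx, smul_inv_smul₀ hx.ne']
      by_cases hxρ : ‖(x : E)‖ < ρ
      · simp [g, hxρ, mul_comm, hfx]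
      · simp [g, hxρ]
    _ = _ := by rw [integral_prod_mul (fun y : sphere (0 : E) 1 => f y)
                  (fun r : Set.Ioi (0 : ℝ) => g r), hradial, mul_comm]

lemma integral_toSphere_comp_isometry [Nontrivial E] {f : E → ℝ} {k : ℕ}
    (hf : ∀ r : ℝ, 0 < r → ∀ x, f (r • x) = r ^ k * f x) (L : E ≃ₗᵢ[ℝ] E) :
    ∫ y : sphere (0 : E) 1, f (L y) ∂(volume : Measure E).toSphere =
      ∫ y : sphere (0 : E) 1, f y ∂(volume : Measure E).toSphere := by
  have hdim : 0 < Module.finrank ℝ E := Module.finrank_pos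
  have hball : ∫ x in ball (0 : E) 1, f (L x) = ∫ x in ball (0 : E) 1, f x := by
    have := L.measurePreserving.setIntegral_preimage_emb
      L.toHomeomorph.measurableEmbedding f (ball 0 1)
    simpa using this
  rw [setIntegral_ball_of_homogeneous (f := fun x => f (L x)) (k := k)
      (fun r hr x => by simp [hf r hr]) one_pos,
    setIntegral_ball_of_homogeneous hf one_pos] at hball
  exact mul_left_cancel₀ (by positivity) hball

lemma integral_toSphere_eq_zero_of_odd [Nontrivial E] {f : E → ℝ} {k : ℕ}
    (hf : ∀ r : ℝ, 0 < r → ∀ x, f (r • x) = r ^ k * f x) (hodd : ∀ x, f (-x) = -f x) :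
    ∫ y : sphere (0 : E) 1, f y ∂(volume : Measure E).toSphere = 0 := by
  have := integral_toSphere_comp_isometry hf (LinearIsometryEquiv.neg ℝ)
  simp only [LinearIsometryEquiv.coe_neg, hodd, integral_neg] at this
  linarith

lemma integral_toSphere_inner_pow_eq [Nontrivial E] {u v : E} (huv : ‖u‖ = ‖v‖) (k : ℕ) :
    ∫ y : sphere (0 : E) 1, ⟪u, (y : E)⟫ ^ k ∂(volume : Measure E).toSphere =
      ∫ y : sphere (0 : E) 1, ⟪v, (y : E)⟫ ^ k ∂(volume : Measure E).toSphere := by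
  rw [← integral_toSphere_comp_isometry (f := fun x => ⟪v, x⟫ ^ k) (k := k)
    (fun r _ x => by rw [inner_smul_right, mul_pow]) ((ℝ ∙ (u - v))ᗮ.reflection)]
  congr with y
  have hinner := LinearIsometryEquiv.inner_map_map ((ℝ ∙ (u - v))ᗮ.reflection) u (y : E)
  rw [Submodule.reflection_sub huv] at hinner
  rw [hinner]

lemma Continuous.integrable_toSphere {f : E → ℝ} (hf : Continuous f) :
    Integrable (fun y : sphere (0 : E) 1 => f y) (volume : Measure E).toSphere :=
  (hf.comp continuous_subtype_val).integrable_of_hasCompactSupport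
    (HasCompactSupport.of_compactSpace _)

lemma integral_toSphere_inner_sq [Nontrivial E] {u : E} (hu : ‖u‖ = 1) :
    ∫ y : sphere (0 : E) 1, ⟪u, (y : E)⟫ ^ 2 ∂(volume : Measure E).toSphere =
      (volume : Measure E).toSphere.real Set.univ / Module.finrank ℝ E := by
  have hdim : 0 < Module.finrank ℝ E := Module.finrank_pos
  let b := stdOrthonormalBasis ℝ E
  have hsum : ∑ i, ∫ y : sphere (0 : E) 1, ⟪b i, (y : E)⟫ ^ 2 ∂(volume : Measure E).toSphere =
      (volume : Measure E).toSphere.real Set.univ := by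
    rw [← integral_finsetSum _ fun i _ =>
      Continuous.integrable_toSphere (f := fun x => ⟪b i, x⟫ ^ 2) (by fun_prop)]
    have hone (y : sphere (0 : E) 1) : ∑ i, ⟪b i, (y : E)⟫ ^ 2 = 1 := by
      simpa using b.sum_sq_norm_inner_right (y : E)
    simp [hone]
  simp_rw [fun i => integral_toSphere_inner_pow_eq (u := b i) (v := u) (by simp [hu]) 2] at hsum
  rw [eq_div_iff (by positivity), ← hsum]
  simp [mul_comm]

lemma integral_toSphere_inner_sq_mul_inner_sq_eq [Nontrivial E] {u v w : E} (hu : ‖u‖ = 1)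
    (hv : ‖v‖ = 1) (hw : ‖w‖ = 1) (huv : ⟪u, v⟫ = 0) :
    ∫ y : sphere (0 : E) 1, ⟪u, (y : E)⟫ ^ 2 * ⟪v, (y : E)⟫ ^ 2 ∂(volume : Measure E).toSphere =
      (∫ y : sphere (0 : E) 1, ⟪w, (y : E)⟫ ^ 4 ∂(volume : Measure E).toSphere) / 3 := by
  have h_int : ∀ z : E, Integrable (fun y : sphere (0 : E) 1 => ⟪z, (y : E)⟫ ^ 4)
      (volume : Measure E).toSphere := fun z =>
    Continuous.integrable_toSphere (f := fun x => ⟪z, x⟫ ^ 4) (by fun_prop)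
  have h_int_mul : Integrable (fun y : sphere (0 : E) 1 => ⟪u, (y : E)⟫ ^ 2 * ⟪v, (y : E)⟫ ^ 2)
      (volume : Measure E).toSphere :=
    Continuous.integrable_toSphere (f := fun x => ⟪u, x⟫ ^ 2 * ⟪v, x⟫ ^ 2) (by fun_prop)
  have hscale (z : E) (hz : ‖z‖ ^ 2 = 2) :
      ∫ y : sphere (0 : E) 1, ⟪z, (y : E)⟫ ^ 4 ∂(volume : Measure E).toSphere =
        4 * ∫ y : sphere (0 : E) 1, ⟪w, (y : E)⟫ ^ 4 ∂(volume : Measure E).toSphere := by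
    have hz' : ‖z‖ = ‖‖z‖ • w‖ := by simp [norm_smul, hw]
    rw [integral_toSphere_inner_pow_eq hz', ← integral_const_mul]
    have hz4 : ‖z‖ ^ 4 = 4 := by
      rw [show (4 : ℕ) = 2 * 2 from rfl, pow_mul, hz]
      norm_num
    simp_rw [real_inner_smul_left, mul_pow, hz4]
  have hadd := hscale (u + v) (by rw [norm_add_sq_real, hu, hv, huv]; norm_num)
  have hsub := hscale (u - v) (by rw [norm_sub_sq_real, hu, hv, huv]; norm_num)
  have h_int_add : Integrable (fun y : sphere (0 : E) 1 => ⟪u, (y : E)⟫ ^ 4 + ⟪v, (y : E)⟫ ^ 4)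
      (volume : Measure E).toSphere := (h_int u).add (h_int v)
  have hexpand : ∫ y : sphere (0 : E) 1, (⟪u + v, (y : E)⟫ ^ 4 + ⟪u - v, (y : E)⟫ ^ 4)
        ∂(volume : Measure E).toSphere =
      ∫ y : sphere (0 : E) 1, (2 * (⟪u, (y : E)⟫ ^ 4 + ⟪v, (y : E)⟫ ^ 4)
        + 12 * (⟪u, (y : E)⟫ ^ 2 * ⟪v, (y : E)⟫ ^ 2)) ∂(volume : Measure E).toSphere := by
    congr with y
    rw [inner_add_left, inner_sub_left]
    ring
  rw [integral_add (h_int _) (h_int _), hadd, hsub,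
    integral_add (h_int_add.const_mul 2) (h_int_mul.const_mul 12),
    integral_const_mul, integral_const_mul, integral_add (h_int _) (h_int _),
    integral_toSphere_inner_pow_eq (hu.trans hw.symm),
    integral_toSphere_inner_pow_eq (hv.trans hw.symm)] at hexpand
  linarith

lemma integral_toSphere_inner_sq_mul_inner_sq [Nontrivial E] {u v : E} (hu : ‖u‖ = 1)
    (hv : ‖v‖ = 1) (huv : ⟪u, v⟫ = 0) :
    ∫ y : sphere (0 : E) 1, ⟪u, (y : E)⟫ ^ 2 * ⟪v, (y : E)⟫ ^ 2 ∂(volume : Measure E).toSphere =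
      (volume : Measure E).toSphere.real Set.univ /
        (Module.finrank ℝ E * (Module.finrank ℝ E + 2)) := by
  have hdim : 0 < Module.finrank ℝ E := Module.finrank_pos
  let b := stdOrthonormalBasis ℝ E
  let i₀ : Fin (Module.finrank ℝ E) := ⟨0, hdim⟩
  set m := ∫ y : sphere (0 : E) 1, ⟪b i₀, (y : E)⟫ ^ 4 ∂(volume : Measure E).toSphere with hm
  have hsum : ∑ i, ∫ y : sphere (0 : E) 1, ⟪b i, (y : E)⟫ ^ 2 * ⟪b i₀, (y : E)⟫ ^ 2
        ∂(volume : Measure E).toSphere =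
      (volume : Measure E).toSphere.real Set.univ / Module.finrank ℝ E := by
    rw [← integral_toSphere_inner_sq (u := b i₀) (by simp), ← integral_finsetSum _ fun i _ =>
      Continuous.integrable_toSphere (f := fun x => ⟪b i, x⟫ ^ 2 * ⟪b i₀, x⟫ ^ 2) (by fun_prop)]
    have hone (y : sphere (0 : E) 1) : ∑ i, ⟪b i, (y : E)⟫ ^ 2 = 1 := by
      simpa using b.sum_sq_norm_inner_right (y : E)
    simp [← Finset.sum_mul, hone]
  have hterm (i : Fin (Module.finrank ℝ E)) :
      ∫ y : sphere (0 : E) 1, ⟪b i, (y : E)⟫ ^ 2 * ⟪b i₀, (y : E)⟫ ^ 2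
        ∂(volume : Measure E).toSphere = m / 3 + if i = i₀ then 2 * m / 3 else 0 := by
    split_ifs with hi
    · subst hi
      simp_rw [← pow_add]
      rw [← hm]
      ring
    · rw [integral_toSphere_inner_sq_mul_inner_sq_eq (w := b i₀) (by simp) (by simp) (by simp)
        (b.orthonormal.2 hi), add_zero]
  simp_rw [hterm, Finset.sum_add_distrib, Finset.sum_ite_eq', Finset.mem_univ, if_true,
    Finset.sum_const, Finset.card_univ, Fintype.card_fin, nsmul_eq_mul] at hsum
  rw [integral_toSphere_inner_sq_mul_inner_sq_eq hu hv (b.norm_eq_one i₀) huv, ← hm,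
    ← div_div, ← hsum]
  field_simp

end SphereMoments

lemma integral_sphereMeasure {n : ℕ} {ρ : ℝ} (hρ : 0 ≤ ρ) {f : EuclideanSpace ℝ (Fin n) → ℝ}
    (hf : Continuous f) :
    ∫ x, f x ∂(sphereMeasure n ρ) = ρ ^ (n - 1) *
      ∫ y : sphere (0 : EuclideanSpace ℝ (Fin n)) 1, f (ρ • (y : EuclideanSpace ℝ (Fin n)))
        ∂(volume : Measure (EuclideanSpace ℝ (Fin n))).toSphere := by
  rw [sphereMeasure, integral_smul_measure, integral_map (by fun_prop)
    hf.aestronglyMeasurable, ENNReal.toReal_ofReal (by positivity), smul_eq_mul]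

lemma hasGradientAt_inner_mul_inner_add {E : Type*} [NormedAddCommGroup E]
    [InnerProductSpace ℝ E] [CompleteSpace E] (u v : E) (a b : ℝ) (x : E) :
    HasGradientAt (fun x => a * ⟪v, x⟫ * ⟪u, x⟫ + b * ⟪u, x⟫)
      ((a * ⟪u, x⟫) • v + (a * ⟪v, x⟫ + b) • u) x := by
  rw [hasGradientAt_iff_hasFDerivAt]
  have hu : HasFDerivAt (fun x => ⟪u, x⟫) (innerSL ℝ u) x := (innerSL ℝ u).hasFDerivAt
  have hv : HasFDerivAt (fun x => ⟪v, x⟫) (innerSL ℝ v) x := (innerSL ℝ v).hasFDerivAt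
  refine (((hv.const_mul a).mul hu).add (hu.const_mul b)).congr_fderiv ?_
  ext y
  simp
  ring

lemma norm_sq_smul_add_smul {E : Type*} [NormedAddCommGroup E] [InnerProductSpace ℝ E]
    {u v : E} (hu : ‖u‖ = 1) (hv : ‖v‖ = 1) (huv : ⟪u, v⟫ = 0) (a b : ℝ) :
    ‖a • v + b • u‖ ^ 2 = a ^ 2 + b ^ 2 := by
  rw [norm_add_sq_real, norm_smul, norm_smul, real_inner_smul_left, real_inner_smul_right,
    real_inner_comm, huv, hu, hv]
  simp

/-- For orthonormal `e, e' ∈ ℝⁿ` (`n ≥ 2`) and `(c₁, c₂) ≠ (0, 0)`, the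
polynomial `P x = c₁ (e'·x)(e·x) + c₂ (e·x)` satisfies
`(1/2)·(∫_{B_{1/2}} |∇P|²)/(∫_{∂B_{1/2}} P²)
  = (c₁²/(2(n+2)) + c₂²)/(c₁²/(4(n+2)) + c₂²) ≤ 2`. -/
theorem stmt6 {n : ℕ} (hn : 2 ≤ n) (e e' : EuclideanSpace ℝ (Fin n))
    (he : ‖e‖ = 1) (he' : ‖e'‖ = 1) (horth : ⟪e, e'⟫ = 0)
    (c₁ c₂ : ℝ) (h : ¬ (c₁ = 0 ∧ c₂ = 0)) :
    let P : EuclideanSpace ℝ (Fin n) → ℝ := fun x => c₁ * ⟪e', x⟫ * ⟪e, x⟫ + c₂ * ⟪e, x⟫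
    (1/2) * (∫ x in ball (0 : EuclideanSpace ℝ (Fin n)) (1/2), ‖gradient P x‖^2) /
        (∫ x, (P x)^2 ∂(sphereMeasure n (1/2)))
      = (c₁^2 / (2 * (n + 2)) + c₂^2) / (c₁^2 / (4 * (n + 2)) + c₂^2) ∧
    (1/2) * (∫ x in ball (0 : EuclideanSpace ℝ (Fin n)) (1/2), ‖gradient P x‖^2) /
        (∫ x, (P x)^2 ∂(sphereMeasure n (1/2)))
      ≤ 2 := by
  intro P
  have hn0 : (0 : ℝ) < n := by exact_mod_cast (by omega : 0 < n)
  have hfin : Module.finrank ℝ (EuclideanSpace ℝ (Fin n)) = n := by simp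
  have : Nontrivial (EuclideanSpace ℝ (Fin n)) :=
    Module.nontrivial_of_finrank_pos (R := ℝ) (by omega)
  set S : ℝ := (volume : Measure (EuclideanSpace ℝ (Fin n))).toSphere.real Set.univ with hS
  have hSpos : 0 < S := by
    exact ENNReal.toReal_pos (Measure.measure_univ_ne_zero.2 (Measure.toSphere_ne_zero _))
      (measure_ne_top _ _)
  have hball : ∫ x in ball (0 : EuclideanSpace ℝ (Fin n)) (1/2), ‖gradient P x‖^2 =
      (1/2) ^ n * S / n * (c₁^2 / (2 * (n + 2)) + c₂^2) := by
    have hgrad (x : EuclideanSpace ℝ (Fin n)) : ‖gradient P x‖^2 =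
        c₁^2 * ⟪e, x⟫^2 + c₁^2 * ⟪e', x⟫^2 + 2 * c₁ * c₂ * ⟪e', x⟫ + c₂^2 := by
      rw [(hasGradientAt_inner_mul_inner_add e e' c₁ c₂ x).gradient,
        norm_sq_smul_add_smul he he' horth]
      ring
    have h_int {f : EuclideanSpace ℝ (Fin n) → ℝ} (hf : Continuous f) :
        IntegrableOn f (ball 0 (1/2)) :=
      (hf.continuousOn.integrableOn_compact (isCompact_closedBall 0 (1/2))).mono_set
        ball_subset_closedBall
    have hsq {u : EuclideanSpace ℝ (Fin n)} (hu : ‖u‖ = 1) :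
        ∫ x in ball (0 : EuclideanSpace ℝ (Fin n)) (1/2), ⟪u, x⟫^2 =
          (1/2) ^ (n + 2) / (n + 2) * (S / n) := by
      rw [setIntegral_ball_of_homogeneous (k := 2)
        (fun r _ x => by rw [inner_smul_right, mul_pow]) (by norm_num),
        integral_toSphere_inner_sq hu, hfin, ← hS]
      norm_num
    have hlin : ∫ x in ball (0 : EuclideanSpace ℝ (Fin n)) (1/2), ⟪e', x⟫ = 0 := by
      have hhom (r : ℝ) (_ : 0 < r) (x : EuclideanSpace ℝ (Fin n)) :
          ⟪e', r • x⟫ = r ^ 1 * ⟪e', x⟫ := by rw [inner_smul_right, pow_one]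
      rw [setIntegral_ball_of_homogeneous hhom (by norm_num),
        integral_toSphere_eq_zero_of_odd hhom (fun x => inner_neg_right _ _), mul_zero]
    have hconst : ∫ x in ball (0 : EuclideanSpace ℝ (Fin n)) (1/2), c₂^2 =
        (1/2) ^ n / n * (c₂^2 * S) := by
      rw [setIntegral_ball_of_homogeneous (k := 0) (fun r _ x => by simp) (by norm_num),
        integral_const, ← hS, hfin]
      simp [mul_comm]
    simp_rw [hgrad]
    rw [integral_add (h_int (by fun_prop)) (h_int (by fun_prop)),
      integral_add (h_int (by fun_prop)) (h_int (by fun_prop)),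
      integral_add (h_int (by fun_prop)) (h_int (by fun_prop)),
      integral_const_mul, integral_const_mul, integral_const_mul, hsq he, hsq he', hlin, hconst]
    field_simp
    ring
  have hsphere : ∫ x, (P x)^2 ∂(sphereMeasure n (1/2)) =
      (1/2) ^ (n + 1) * S / n * (c₁^2 / (4 * (n + 2)) + c₂^2) := by
    rw [integral_sphereMeasure (by norm_num) (by fun_prop)]
    have hP (y : EuclideanSpace ℝ (Fin n)) : (P ((1/2 : ℝ) • y))^2 =
        c₁^2 / 16 * (⟪e, y⟫^2 * ⟪e', y⟫^2) + c₁ * c₂ / 4 * (⟪e', y⟫ * ⟪e, y⟫^2)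
          + c₂^2 / 4 * ⟪e, y⟫^2 := by
      simp only [P, inner_smul_right]
      ring
    have hodd : ∫ y : sphere (0 : EuclideanSpace ℝ (Fin n)) 1,
        ⟪e', (y : EuclideanSpace ℝ (Fin n))⟫ * ⟪e, (y : EuclideanSpace ℝ (Fin n))⟫^2
          ∂(volume : Measure (EuclideanSpace ℝ (Fin n))).toSphere = 0 :=
      integral_toSphere_eq_zero_of_odd (k := 3) (f := fun y => ⟪e', y⟫ * ⟪e, y⟫^2)
        (fun r _ x => by simp only [inner_smul_right]; ring)
        (fun x => by simp only [inner_neg_right]; ring)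
    simp_rw [hP]
    rw [integral_add, integral_add, integral_const_mul, integral_const_mul, integral_const_mul,
      hodd, integral_toSphere_inner_sq he, integral_toSphere_inner_sq_mul_inner_sq he he' horth,
      hfin, ← hS]
    · obtain ⟨m, rfl⟩ : ∃ m, n = m + 1 := ⟨n - 1, by omega⟩
      rw [Nat.add_sub_cancel]
      field_simp
      ring
    · exact Continuous.integrable_toSphere (f := fun y => c₁^2 / 16 * (⟪e, y⟫^2 * ⟪e', y⟫^2))
        (by fun_prop)
    · exact Continuous.integrable_toSphere (f := fun y => c₁ * c₂ / 4 * (⟪e', y⟫ * ⟪e, y⟫^2))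
        (by fun_prop)
    · exact Continuous.integrable_toSphere (f := fun y => c₁^2 / 16 * (⟪e, y⟫^2 * ⟪e', y⟫^2) +
        c₁ * c₂ / 4 * (⟪e', y⟫ * ⟪e, y⟫^2)) (by fun_prop)
    · exact Continuous.integrable_toSphere (f := fun y => c₂^2 / 4 * ⟪e, y⟫^2) (by fun_prop)
  have hden : 0 < c₁^2 / (4 * (n + 2)) + c₂^2 := by
    by_cases h1 : c₁ = 0
    · have : c₂ ≠ 0 := fun h2 => h ⟨h1, h2⟩
      positivity
    · positivity
  have hquot : (1/2) * (∫ x in ball (0 : EuclideanSpace ℝ (Fin n)) (1/2), ‖gradient P x‖^2) /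
        (∫ x, (P x)^2 ∂(sphereMeasure n (1/2)))
      = (c₁^2 / (2 * (n + 2)) + c₂^2) / (c₁^2 / (4 * (n + 2)) + c₂^2) := by
    have hfactor : (1/2) ^ (n + 1) * S / n ≠ 0 := by positivity
    rw [hball, hsphere,
      ← mul_div_mul_left (c₁^2 / (2 * (n + 2)) + c₂^2) _ hfactor]
    congr 1
    ring
  refine ⟨hquot, ?_⟩
  rw [hquot, div_le_iff₀ hden]
  have : c₁^2 / (2 * ((n : ℝ) + 2)) = 2 * (c₁^2 / (4 * (n + 2))) := by
    field_simp
    ring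
  nlinarith [sq_nonneg c₂]
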